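/- The function f_∞ is jointly continuous on ℝ^m × X. -/

import Mathlib

/-- The asymptotic approximation `f_∞(y, x) = sup_{t>0} f(t·y, x)/t` of a function
`f : ℝ^m × X → ℝ`. -/
noncomputable def finfty2 {m : ℕ} {X : Type*}
    (f : EuclideanSpace ℝ (Fin m) × X → ℝ) (p : EuclideanSpace ℝ (Fin m) × X) : ℝ :=
  ⨆ t : Set.Ioi (0 : ℝ), f ((t : ℝ) • p.1, p.2) / (t : ℝ)

theorem bddAbove_finfty2 {m : ℕ} {X : Type*}
    {f : EuclideanSpace ℝ (Fin m) × X → ℝ} {L : NNReal} {x : X} (h0 : f (0, x) = 0)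
    (hlip : LipschitzWith L (fun y => f (y, x))) (y : EuclideanSpace ℝ (Fin m)) :
    BddAbove (Set.range fun t : Set.Ioi (0 : ℝ) => f ((t : ℝ) • y, x) / (t : ℝ)) := by
  refine ⟨L * ‖y‖, ?_⟩
  rintro _ ⟨⟨t, ht : 0 < t⟩, rfl⟩
  have h := hlip.dist_le_mul (t • y) 0
  simp only [h0, dist_zero_right, norm_smul, Real.norm_eq_abs, abs_of_pos ht] at h
  rw [div_le_iff₀ ht]
  linarith [le_abs_self (f (t • y, x))]

theorem div_le_finfty2 {m : ℕ} {X : Type*}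
    {f : EuclideanSpace ℝ (Fin m) × X → ℝ} {L : NNReal} {x : X} (h0 : f (0, x) = 0)
    (hlip : LipschitzWith L (fun y => f (y, x))) (y : EuclideanSpace ℝ (Fin m))
    {t : ℝ} (ht : 0 < t) : f (t • y, x) / t ≤ finfty2 f (y, x) :=
  le_ciSup (bddAbove_finfty2 h0 hlip y) ⟨t, ht⟩

/-- Subhomogeneity of the asymptotic approximation. -/
theorem finfty2_le_finfty2_smul_div {m : ℕ} {X : Type*}
    {f : EuclideanSpace ℝ (Fin m) × X → ℝ} {L : NNReal} {x : X} (h0 : f (0, x) = 0)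
    (hlip : LipschitzWith L (fun y => f (y, x))) (y : EuclideanSpace ℝ (Fin m))
    {t : ℝ} (ht : 0 < t) : finfty2 f (y, x) ≤ finfty2 f (t • y, x) / t := by
  have : Nonempty (Set.Ioi (0 : ℝ)) := ⟨⟨1, Set.mem_Ioi.2 one_pos⟩⟩
  refine ciSup_le ?_
  rintro ⟨s, hs : 0 < s⟩
  have h := div_le_finfty2 h0 hlip (t • y) (div_pos hs ht)
  rw [smul_smul, div_mul_cancel₀ s ht.ne'] at h
  rw [le_div_iff₀ ht]
  rwa [div_div_eq_mul_div, ← div_mul_eq_mul_div] at h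

/-- Let `X` be a topological space and `f : ℝ^m × X → ℝ` continuous with
`f(0, x) = 0`, convex and `L`-Lipschitz in the first variable (uniformly in `x`),
and `f(y, x) ≥ f_∞(y, x) − A₀` for some `A₀ ≥ 0`. Then `f_∞` is jointly continuous
on `ℝ^m × X`. -/
theorem stmt10 {m : ℕ} {X : Type*} [TopologicalSpace X]
    (f : EuclideanSpace ℝ (Fin m) × X → ℝ) (L : NNReal) (A₀ : ℝ)
    (hf : Continuous f)
    (h0 : ∀ x : X, f (0, x) = 0)
    (hconv : ∀ x : X, ConvexOn ℝ Set.univ (fun y => f (y, x)))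
    (hlip : ∀ x : X, LipschitzWith L (fun y => f (y, x)))
    (hA₀ : 0 ≤ A₀)
    (hU : ∀ (y : EuclideanSpace ℝ (Fin m)) (x : X), f (y, x) ≥ finfty2 f (y, x) - A₀) :
    Continuous (finfty2 f) := by
  have hlim : TendstoUniformly
      (fun (t : ℝ) (p : EuclideanSpace ℝ (Fin m) × X) => f (t • p.1, p.2) / t)
      (finfty2 f) Filter.atTop := by
    rw [Metric.tendstoUniformly_iff]
    intro ε hε
    filter_upwards [Filter.eventually_gt_atTop 0, Filter.eventually_gt_atTop (A₀ / ε)]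
      with t ht htε
    rintro ⟨y, x⟩
    have hlower := div_le_finfty2 (h0 x) (hlip x) y ht
    have hupper : finfty2 f (y, x) ≤ f (t • y, x) / t + A₀ / t := by
      refine (finfty2_le_finfty2_smul_div (h0 x) (hlip x) y ht).trans ?_
      rw [← add_div]
      gcongr
      linarith [hU (t • y) x]
    have hsmall : A₀ / t < ε := (div_lt_comm₀ hε ht).1 htε
    rw [Real.dist_eq, abs_of_nonneg (sub_nonneg.2 hlower)]
    linarith
  exact hlim.continuous (Filter.Frequently.of_forall fun t => by fun_prop)
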